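/- Let n ≥ 1 and d be integers with |d| ≥ 2, with d-sequence n = n_0 > n_1 > ⋯ > n_k = n_{k+1} and m = n_k. Let 𝒱 be a set containing exactly one element of each orbit of the permutation v ↦ d·v of ℤ/m other than the orbit {0}, and for v ∈ 𝒱 let o(v) be the size of its orbit. Then Σ(n,d) ≅ [⊕_{i=0}^{k−1} (ℤ/|d|^{i+1})^{n_i − 2n_{i+1} + n_{i+2}}] ⊕ [⊕_{v ∈ 𝒱} ℤ/|d^{o(v)} − 1|]. -/

import Mathlib

open Finset

noncomputable section

/-- The ring `ℤ[x]/(x^n - 1)`, realized as the group algebra `ℤ[ℤ/n]`;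
the class of `x^j` (for `j : ℤ`) corresponds to `xp n (j : ZMod n)`. -/
abbrev Rn (n : ℕ) : Type := AddMonoidAlgebra ℤ (ZMod n)

/-- The class of `x^w` in `ℤ[x]/(x^n - 1)`. -/
def xp (n : ℕ) (w : ZMod n) : Rn n := AddMonoidAlgebra.single w 1

/-- `e_v = x^v - 1`. -/
def eV (n : ℕ) (w : ZMod n) : Rn n := xp n w - 1

/-- `ε_v = d·e_v - e_{d·v}`. -/
def epsV (n : ℕ) (d : ℤ) (w : ZMod n) : Rn n := d • eV n w - eV n ((d : ZMod n) * w)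

/-- `𝒵_n`, the ℤ-span of the `e_v`, `1 ≤ v ≤ n-1`. -/
def ZSpan (n : ℕ) : Submodule ℤ (Rn n) :=
  Submodule.span ℤ {a : Rn n | ∃ v : ℤ, 1 ≤ v ∧ v ≤ (n : ℤ) - 1 ∧ a = eV n (v : ZMod n)}

/-- `ℰ_{n,d}`, the ℤ-span of the `ε_v`, `1 ≤ v ≤ n-1`. -/
def ESpan (n : ℕ) (d : ℤ) : Submodule ℤ (Rn n) :=
  Submodule.span ℤ {a : Rn n | ∃ v : ℤ, 1 ≤ v ∧ v ≤ (n : ℤ) - 1 ∧ a = epsV n d (v : ZMod n)}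

/-- `1 + x + ⋯ + x^{|d|-1}`. -/
def geomT (n : ℕ) (d : ℤ) : Rn n := ∑ i ∈ Finset.range d.natAbs, xp n (i : ZMod n)

/-- `f_v`: the Laplacian row polynomial of `DB(n,d)` (for `d ≥ 0`) resp. of
`Ktz(n,|d|)` (for `d < 0`). -/
def fV (n : ℕ) (d : ℤ) (v : ℤ) : Rn n :=
  if 0 ≤ d then d • xp n ((v : ZMod n)) - xp n (((d * v : ℤ) : ZMod n)) * geomT n d
  else d • xp n ((v : ZMod n)) + xp n (((d * (v + 1) : ℤ) : ZMod n)) * geomT n d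

/-- `F_{n,d}`, the ℤ-span of the `f_v`, `1 ≤ v ≤ n-1`. -/
def FSpan (n : ℕ) (d : ℤ) : Submodule ℤ (Rn n) :=
  Submodule.span ℤ {a : Rn n | ∃ v : ℤ, 1 ≤ v ∧ v ≤ (n : ℤ) - 1 ∧ a = fV n d v}

/-- The sand dune group `Σ(n,d) = 𝒵_n / ℰ_{n,d}`. -/
abbrev SandDune (n : ℕ) (d : ℤ) :=
  ZSpan n ⧸ Submodule.comap (ZSpan n).subtype (ESpan n d)

/-- The sandpile (critical) group `S(n,d) = 𝒵_n / F_{n,d}`. -/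
abbrev Sandpile (n : ℕ) (d : ℤ) :=
  ZSpan n ⧸ Submodule.comap (ZSpan n).subtype (FSpan n d)

/-- The `d`-sequence of `n`: `n_0 = n`, `n_{i+1} = n_i / gcd(n_i, |d|)`. -/
def dSeq (n : ℕ) (d : ℤ) : ℕ → ℕ
  | 0 => n
  | i + 1 => dSeq n d i / Nat.gcd (dSeq n d i) d.natAbs

section FunctionalGraph

open Function

/-- A homomorphism to a product of cyclic groups that maps generators `b i`, killed by `N i`,
to the standard generators is bijective. -/
theorem bijective_of_map_eq_single {G : Type*} [AddCommGroup G] {ι : Type*} [Fintype ι] [DecidableEq ι] (N : ι → ℕ)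
    (φ : G →+ ((i : ι) → ZMod (N i))) (b : ι → G) (hN : ∀ i, N i • b i = 0)
    (hφ : ∀ i, φ (b i) = Pi.single i 1) (hb : AddSubgroup.closure (Set.range b) = ⊤) :
    Bijective φ := by
  let ψ : ((i : ι) → ZMod (N i)) →+ G :=
    ∑ i, (ZMod.lift (N i) ⟨zmultiplesHom G (b i), by simpa using hN i⟩).comp
      (Pi.evalAddMonoidHom (fun i => ZMod (N i)) i)
  have hψ : ∀ i, ψ (Pi.single i 1) = b i := by
    intro i
    simp only [ψ, AddMonoidHom.finsetSum_apply, AddMonoidHom.comp_apply, Pi.evalAddMonoidHom_apply]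
    rw [Finset.sum_eq_single i]
    · have := ZMod.lift_coe (N i) ⟨zmultiplesHom G (b i), by simpa using hN i⟩ 1
      simpa using this
    · intro j _ hj
      rw [Pi.single_eq_of_ne hj, map_zero]
    · simp
  have h1 : ψ.comp φ = AddMonoidHom.id G := by
    apply AddMonoidHom.eq_of_eqOn_dense hb
    rintro _ ⟨i, rfl⟩
    simp [hφ, hψ]
  have h2 : φ.comp ψ = AddMonoidHom.id _ := by
    refine AddMonoidHom.functions_ext _ _ _ fun i x => ?_
    obtain ⟨z, rfl⟩ := ZMod.intCast_surjective x
    have : (Pi.single i (z : ZMod (N i)) : (i : ι) → ZMod (N i)) = z • Pi.single i 1 := by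
      rw [← Pi.single_smul]; simp
    rw [this, map_zsmul, map_zsmul]
    simp [hψ, hφ]
  exact ⟨LeftInverse.injective (g := ψ) (DFunLike.congr_fun h1),
    RightInverse.surjective (g := ψ) (DFunLike.congr_fun h2)⟩

theorem range_iterate_anti {X : Type*} (f : X → X) {i j : ℕ} (h : i ≤ j) :
    Set.range f^[j] ⊆ Set.range f^[i] := by
  rintro _ ⟨y, rfl⟩
  exact ⟨f^[j - i] y, by rw [← iterate_add_apply, Nat.add_sub_cancel' h]⟩

theorem range_iterate_stable {X : Type*} (f : X → X) (k : ℕ)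
    (hk : Set.range f^[k + 1] = Set.range f^[k]) (i : ℕ) :
    Set.range f^[k] ⊆ Set.range f^[i] := by
  induction i with
  | zero => simp
  | succ i ih =>
    rw [← hk]
    rintro _ ⟨y, rfl⟩
    obtain ⟨z, hz⟩ := ih ⟨y, rfl⟩
    exact ⟨z, by rw [iterate_succ_apply', iterate_succ_apply', hz]⟩

/-- `s` is a section of `f` on its image that lowers the depth in the iterated images by at most
one. -/
structure IsSec {X : Type*} (f s : X → X) : Prop where
  right_inv : ∀ x ∈ Set.range f, f (s x) = x
  mem_range : ∀ i x, x ∈ Set.range f^[i + 1] → s x ∈ Set.range f^[i]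

/-- A section of `f` that picks preimages as deep as possible in the iterated images of `f`. -/
theorem exists_isSec {X : Type*} (f : X → X) (k : ℕ)
    (hk : Set.range f^[k + 1] = Set.range f^[k]) :
    ∃ s : X → X, IsSec f s := by
  classical
  have key : ∀ x, ∃ y, (x ∈ Set.range f → f y = x) ∧
      ∀ i, x ∈ Set.range f^[i + 1] → y ∈ Set.range f^[i] := by
    intro x
    by_cases hx : x ∈ Set.range f
    · set h := Nat.findGreatest (fun i => x ∈ Set.range f^[i]) (k + 1) with hh
      have h1 : 1 ≤ h := Nat.le_findGreatest (by omega) (by simpa using hx)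
      obtain ⟨y, hy⟩ : x ∈ Set.range f^[h] :=
        Nat.findGreatest_spec (P := fun i => x ∈ Set.range f^[i]) (m := 1) (by omega)
          (by simpa using hx)
      refine ⟨f^[h - 1] y, fun _ => ?_, fun i hi => ?_⟩
      · rw [← iterate_succ_apply' f, Nat.succ_eq_add_one, Nat.sub_add_cancel h1, hy]
      · by_cases hik : i ≤ k
        · have : i + 1 ≤ h := Nat.le_findGreatest (by omega) hi
          exact range_iterate_anti f (by omega) ⟨y, rfl⟩
        · have : k + 1 ≤ h := Nat.le_findGreatest le_rfl (range_iterate_anti f (by omega) hi)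
          exact range_iterate_stable f k hk i (range_iterate_anti f (by omega) ⟨y, rfl⟩)
    · refine ⟨x, fun h => absurd h hx, fun i hi => absurd
        (range_iterate_anti f (i := 1) (by omega) hi) (by simpa using hx)⟩
  choose s hs using key
  exact ⟨s, fun x => (hs x).1, fun i x => (hs x).2 i⟩

namespace IsSec
variable {X : Type*} {f s : X → X} (hs : IsSec f s)
include hs

theorem apply_iterate {i : ℕ} {x : X} (hx : x ∈ Set.range f^[i + 1]) : f (s x) = x :=
  hs.right_inv x (by simpa using range_iterate_anti f (i := 1) (by omega) hx)

theorem iterate_mem {i l : ℕ} {x : X} (hx : x ∈ Set.range f^[i + l]) :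
    s^[l] x ∈ Set.range f^[i] := by
  induction l generalizing x with
  | zero => simpa using hx
  | succ l ih =>
    rw [iterate_succ_apply]
    exact ih (hs.mem_range _ _ hx)

theorem iterate_iterate {i j : ℕ} {x : X} (hx : x ∈ Set.range f^[i + j]) :
    f^[j] (s^[i + j] x) = s^[i] x := by
  induction j with
  | zero => rfl
  | succ j ih =>
    rw [iterate_succ_apply, ← Nat.add_assoc, iterate_succ_apply',
      hs.apply_iterate (i := 0), ih (range_iterate_anti f (by omega) hx)]
    exact hs.iterate_mem (range_iterate_anti f (by omega) hx)

theorem apply_apply {x : X} (hx : x ∈ Set.range f) : s (f (s x)) = s x := by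
  rw [hs.right_inv x hx]

theorem ncard_tops [Finite X] (i : ℕ) :
    ({u | u ∈ Set.range f^[i] ∧ u ∉ Set.range f^[i + 1] ∧ s (f u) ≠ u}.ncard : ℤ) =
      (Set.range f^[i]).ncard - 2 * (Set.range f^[i + 1]).ncard +
        (Set.range f^[i + 2]).ncard := by
  set A : ℕ → Set X := fun i => Set.range f^[i] \ Set.range f^[i + 1] with hA
  have hAcard : ∀ i, ((A i).ncard : ℤ) =
      (Set.range f^[i]).ncard - (Set.range f^[i + 1]).ncard := by
    intro i
    have := Set.ncard_sdiff_add_ncard_of_subset (range_iterate_anti f (Nat.le_succ i))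
    simp only [hA]
    simp only [Nat.succ_eq_add_one] at this
    omega
  have hsub : s '' A (i + 1) ⊆ A i := by
    rintro _ ⟨x, ⟨hx, hx'⟩, rfl⟩
    refine ⟨hs.mem_range _ _ hx, fun ⟨y, hy⟩ => hx' ⟨y, ?_⟩⟩
    rw [iterate_succ_apply', hy, hs.apply_iterate hx]
  have hinj : Set.InjOn s (A (i + 1)) := by
    intro x hx y hy hxy
    rw [← hs.apply_iterate hx.1, hxy, hs.apply_iterate hy.1]
  have hset : {u | u ∈ Set.range f^[i] ∧ u ∉ Set.range f^[i + 1] ∧ s (f u) ≠ u} =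
      A i \ (s '' A (i + 1)) := by
    ext u
    constructor
    · rintro ⟨h1, h2, h3⟩
      refine ⟨⟨h1, h2⟩, ?_⟩
      rintro ⟨x, hx, rfl⟩
      exact h3 (by rw [hs.apply_iterate hx.1])
    · rintro ⟨⟨h1, h2⟩, h3⟩
      refine ⟨h1, h2, fun h => h3 ⟨f u, ⟨?_, fun h' => h2 ?_⟩, h⟩⟩
      · obtain ⟨y, rfl⟩ := h1
        exact ⟨y, iterate_succ_apply' f i y⟩
      · rw [← h]
        exact hs.mem_range _ _ h'
  have h := Set.ncard_sdiff_add_ncard_of_subset hsub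
  rw [hinj.ncard_image] at h
  rw [hset]
  have h1 := hAcard i
  have h2 : ((A (i + 1)).ncard : ℤ) =
      (Set.range f^[i + 1]).ncard - (Set.range f^[i + 2]).ncard := hAcard (i + 1)
  omega

end IsSec

open Classical in
/-- The coordinate of `x` along the chain ending in `u`. -/
def nilCoord {X : Type*} (f : X → X) (d : ℤ) (i : ℕ) (u x : X) :
    ZMod (d.natAbs ^ (i + 1)) :=
  ∑ j ∈ Finset.range (i + 1), if f^[j] x = u then (d : ZMod (d.natAbs ^ (i + 1))) ^ (i - j) else 0

theorem ZMod.intCast_pow_natAbs_pow (d : ℤ) (i : ℕ) :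
    (d : ZMod (d.natAbs ^ i)) ^ i = 0 := by
  rw [← Int.cast_pow, ZMod.intCast_zmod_eq_zero_iff_dvd]
  push_cast
  rw [← abs_pow]
  exact abs_dvd_self _

theorem nilCoord_apply {X : Type*} (f : X → X) (d : ℤ) (i : ℕ) (u x : X)
    (hu : u ∉ Set.range f^[i + 1]) :
    nilCoord f d i u (f x) = d • nilCoord f d i u x := by
  classical
  unfold nilCoord
  rw [Finset.sum_range_succ, Finset.sum_range_succ', smul_add, Finset.smul_sum]
  have h1 : ¬ f^[i] (f x) = u := fun h => hu ⟨x, h⟩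
  rw [if_neg h1, add_zero]
  have h2 : (d • if f^[0] x = u then (d : ZMod (d.natAbs ^ (i + 1))) ^ (i - 0) else 0) = 0 := by
    split_ifs
    · rw [zsmul_eq_mul, Nat.sub_zero, ← pow_succ', ZMod.intCast_pow_natAbs_pow]
    · simp
  rw [h2, add_zero]
  refine Finset.sum_congr rfl fun j hj => ?_
  rw [Finset.mem_range] at hj
  rw [← iterate_succ_apply f]
  split_ifs
  · rw [zsmul_eq_mul, ← pow_succ']
    congr 1
    omega
  · simp

theorem nilCoord_eq_zero {X : Type*} (f : X → X) (d : ℤ) (i : ℕ) (u x : X)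
    (hu : u ∉ Set.range f^[i + 1]) (hx : ∀ j, x ∈ Set.range f^[j]) :
    nilCoord f d i u x = 0 := by
  classical
  refine Finset.sum_eq_zero fun j hj => if_neg ?_
  rintro rfl
  obtain ⟨y, rfl⟩ := hx (i + 1)
  exact hu ⟨f^[j] y, (Function.Commute.iterate_iterate_self f (i+1) j).eq y⟩

theorem IsSec.nilCoord_sub {X : Type*} {f s : X → X} (hs : IsSec f s) (d : ℤ) {i i' : ℕ}
    {u u' : X} (hu : u ∈ Set.range f^[i]) (hus' : s (f u') ≠ u') (hi : u = u' → i = i') [Decidable (u = u')] :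
    nilCoord f d i' u' (s^[i] u) - nilCoord f d i' u' (s^[i + 1] (f u)) =
      if u = u' then 1 else 0 := by
  classical
  have hfu : f u ∈ Set.range f^[i + 1] := by
    obtain ⟨y, rfl⟩ := hu
    exact ⟨y, iterate_succ_apply' f i y⟩
  have pref : ∀ j l x, x ∈ Set.range f^[l + 1 + j] → f^[j] (s^[l + 1 + j] x) ≠ u' := by
    intro j l x hx h
    rw [hs.iterate_iterate hx, iterate_succ_apply'] at h
    apply hus'
    rw [← h, hs.apply_apply]
    have := hs.iterate_mem (i := 1) (l := l) (range_iterate_anti f (by omega) hx)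
    simpa using this
  unfold nilCoord
  rw [← Finset.sum_sub_distrib]
  have hterm : ∀ j, j ≠ i → ((f^[j] (s^[i] u) = u') ↔ (f^[j] (s^[i + 1] (f u)) = u')) := by
    intro j hj
    rcases lt_or_gt_of_ne hj with h | h
    · obtain ⟨l, rfl⟩ : ∃ l, i = l + 1 + j := ⟨i - j - 1, by omega⟩
      refine iff_of_false (pref j l u hu) ?_
      have := pref j (l + 1) (f u) (by convert hfu using 3; omega)
      convert this using 4
      omega
    · obtain ⟨l, rfl⟩ : ∃ l, j = l + (i + 1) := ⟨j - (i + 1), by omega⟩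
      have h1 := hs.iterate_iterate (i := 0) (j := i) (x := u) (by simpa using hu)
      have h2 := hs.iterate_iterate (i := 0) (j := i + 1) (x := f u) (by simpa using hfu)
      simp only [Nat.zero_add, iterate_zero, id] at h1 h2
      rw [iterate_add_apply f l (i + 1), iterate_add_apply f l (i + 1), h2, iterate_succ_apply', h1]
  have hi1 : f^[i] (s^[i] u) = u := by
    simpa using hs.iterate_iterate (i := 0) (j := i) (x := u) (by simpa using hu)
  have hi2 : f^[i] (s^[i + 1] (f u)) ≠ u' := by
    have := pref i 0 (f u) (by convert hfu using 3; omega)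
    rwa [show 0 + 1 + i = i + 1 by omega] at this
  rw [Finset.sum_eq_single i]
  · rw [hi1, if_neg hi2, sub_zero]
    split_ifs with h
    · rw [hi h]; simp
    · rfl
  · intro j _ hj
    simp only [hterm j hj, sub_self]
  · intro hni
    rw [hi1, if_neg hi2, if_neg, sub_zero]
    intro h
    rw [hi h] at hni
    simp at hni

open Classical in
/-- The coordinate of `y` along the cycle through `v`. -/
def cycCoord {Y : Type*} (g : Y → Y) (d : ℤ) (v y : Y) :
    ZMod (d ^ minimalPeriod g v - 1).natAbs :=
  if h : ∃ i, g^[i] v = y then (d : ZMod (d ^ minimalPeriod g v - 1).natAbs) ^ (Nat.find h) else 0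

section CycCoord

variable {Y : Type*} {g : Y → Y} (hg : Injective g)
include hg

theorem pow_eq_pow_of_iterate (d : ℤ) (v : Y) {i j : ℕ} (h : g^[i] v = g^[j] v) :
    (d : ZMod (d ^ minimalPeriod g v - 1).natAbs) ^ i = (d : ZMod _) ^ j := by
  wlog hij : i ≤ j generalizing i j
  · exact (this h.symm (by omega)).symm
  obtain ⟨l, rfl⟩ := Nat.exists_eq_add_of_le hij
  rw [iterate_add_apply] at h
  have hl : IsPeriodicPt g l v := (hg.iterate i h).symm
  obtain ⟨t, rfl⟩ := hl.minimalPeriod_dvd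
  have h1 : (d : ZMod (d ^ minimalPeriod g v - 1).natAbs) ^ minimalPeriod g v = 1 := by
    rw [← sub_eq_zero]
    have : ((d ^ minimalPeriod g v - 1 : ℤ) : ZMod (d ^ minimalPeriod g v - 1).natAbs) = 0 := by
      rw [ZMod.intCast_zmod_eq_zero_iff_dvd]
      exact Int.natAbs_dvd_self
    simpa using this
  rw [pow_add, pow_mul, h1, one_pow, mul_one]

theorem cycCoord_iterate (d : ℤ) (v : Y) (i : ℕ) : cycCoord g d v (g^[i] v) = (d : ZMod _) ^ i := by
  classical
  have h : ∃ j, g^[j] v = g^[i] v := ⟨i, rfl⟩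
  rw [cycCoord, dif_pos h]
  exact pow_eq_pow_of_iterate hg d v (Nat.find_spec h)

omit hg in
theorem cycCoord_eq_zero (d : ℤ) (v y : Y) (h : ∀ i, g^[i] v ≠ y) : cycCoord g d v y = 0 := by
  rw [cycCoord, dif_neg]
  rintro ⟨i, hi⟩
  exact h i hi

theorem cycCoord_apply (d : ℤ) (v y : Y) (hv : 0 < minimalPeriod g v) :
    cycCoord g d v (g y) = d • cycCoord g d v y := by
  by_cases h : ∃ i, g^[i] v = y
  · obtain ⟨i, rfl⟩ := h
    rw [← iterate_succ_apply' g, cycCoord_iterate hg, cycCoord_iterate hg, zsmul_eq_mul, pow_succ']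
  · push Not at h
    rw [cycCoord_eq_zero d v y h, smul_zero, cycCoord_eq_zero]
    intro i hi
    rw [← iterate_add_minimalPeriod_eq] at hi
    obtain ⟨l, hl⟩ : ∃ l, i + minimalPeriod g v = l + 1 := ⟨i + minimalPeriod g v - 1, by omega⟩
    rw [hl, iterate_succ_apply'] at hi
    exact h l (hg hi)

end CycCoord

/-- The group generated by the `e x` with relations `d • e x = e (f x)` and `e x₀ = 0`, for a
self-map `f` of a finite set that becomes the bijection `g` on the `k`-th iterated image. -/
theorem addEquiv_of_functional_graph {X Y G : Type} [Finite X] [AddCommGroup G]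
    (f : X → X) (g : Y → Y) (q : X → Y) (x₀ : X) (d : ℤ) (k : ℕ) (e : X → G)
    (hx₀ : f x₀ = x₀) (hq : Surjective q) (hqf : ∀ x, q (f x) = g (q x))
    (hqk : ∀ x y, q x = q y ↔ f^[k] x = f^[k] y) (hg : Bijective g)
    (he₀ : e x₀ = 0) (he : ∀ x, d • e x = e (f x))
    (hgen : AddSubgroup.closure (Set.range e) = ⊤)
    (hlift : ∀ (A : Type) [AddCommGroup A] (a : X → A), a x₀ = 0 → (∀ x, d • a x = a (f x)) →
      ∃ φ : G →+ A, ∀ x, φ (e x) = a x)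
    (V : Finset Y) (h0 : q x₀ ∉ V) (hcover : ∀ w, w ≠ q x₀ → ∃ v ∈ V, ∃ i, g^[i] v = w)
    (hsep : ∀ v ∈ V, ∀ v' ∈ V, (∃ i, g^[i] v = v') → v = v')
    (hper : ∀ v, 0 < minimalPeriod g v)
    (c : Fin k → ℕ) (hc : ∀ i : Fin k, c i =
      (((Set.range f^[(i : ℕ)]).ncard : ℤ) - 2 * (Set.range f^[(i : ℕ) + 1]).ncard +
        (Set.range f^[(i : ℕ) + 2]).ncard).toNat) :
    Nonempty (G ≃+ (((i : Fin k) → Fin (c i) → ZMod (d.natAbs ^ ((i : ℕ) + 1))) ×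
      ((v : V) → ZMod (d ^ minimalPeriod g v.1 - 1).natAbs))) := by
  classical
  have hqi : ∀ i x, q (f^[i] x) = g^[i] (q x) := fun i x =>
    (Semiconj.iterate_right (f := q) (ga := f) (gb := g) hqf i) x
  have hqinj : ∀ x ∈ Set.range f^[k], ∀ y ∈ Set.range f^[k], q x = q y → x = y := by
    rintro _ ⟨x, rfl⟩ _ ⟨y, rfl⟩ h
    rw [hqi, hqi] at h
    exact (hqk _ _).1 (hg.1.iterate k h)
  have hstab : Set.range f^[k + 1] = Set.range f^[k] := by
    refine (range_iterate_anti f (Nat.le_succ k)).antisymm ?_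
    rintro _ ⟨x, rfl⟩
    obtain ⟨y, hy⟩ := hg.2 (q x)
    obtain ⟨z, rfl⟩ := hq y
    exact ⟨z, by rw [iterate_succ_apply, ← hqk, hqf, hy]⟩
  have hper_range : ∀ x ∈ Set.range f^[k], ∀ j, x ∈ Set.range f^[j] := by
    exact fun x hx j => range_iterate_stable f k hstab j hx
  obtain ⟨s, hs⟩ := exists_isSec f k hstab
  have hx₀r : ∀ j, x₀ ∈ Set.range f^[j] := fun j => ⟨x₀, iterate_fixed hx₀ j⟩
  -- representatives of the nilpotent chains
  have hε : ∀ i : Fin k, Nonempty (Fin (c i) ≃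
      {u | u ∈ Set.range f^[(i : ℕ)] ∧ u ∉ Set.range f^[(i : ℕ) + 1] ∧ s (f u) ≠ u}) := by
    intro i
    have := hs.ncard_tops i
    have h2 : Nat.card {u | u ∈ Set.range f^[(i : ℕ)] ∧ u ∉ Set.range f^[(i : ℕ) + 1] ∧
      s (f u) ≠ u} = c i := by
      rw [hc i, ← this]
      rfl
    exact ⟨(Finite.equivFinOfCardEq h2).symm⟩
  let ε := fun i => (hε i).some
  have hxv : ∀ v : Y, ∃ x ∈ Set.range f^[k], q x = v := by
    intro v
    obtain ⟨w, rfl⟩ := (hg.2.iterate k) v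
    obtain ⟨z, rfl⟩ := hq w
    exact ⟨f^[k] z, ⟨z, rfl⟩, hqi k z⟩
  choose p hpr hpq using hxv
  have hiter : ∀ i x, d ^ i • e x = e (f^[i] x) := by
    intro i x
    induction i with
    | zero => simp
    | succ i ih => rw [pow_succ', mul_smul, ih, he, iterate_succ_apply']
  let ι := (Σ i : Fin k, Fin (c i)) ⊕ V
  let N : ι → ℕ := Sum.elim (fun t => d.natAbs ^ ((t.1 : ℕ) + 1))
    (fun v => (d ^ minimalPeriod g v.1 - 1).natAbs)
  let a : X → (t : ι) → ZMod (N t) := fun x t => match t with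
    | Sum.inl t => nilCoord f d t.1 (ε t.1 t.2).1 x
    | Sum.inr v => cycCoord g d v.1 (q x)
  let b : ι → G := Sum.elim
    (fun t => e (s^[(t.1 : ℕ)] (ε t.1 t.2).1) - e (s^[(t.1 : ℕ) + 1] (f (ε t.1 t.2).1)))
    (fun v => e (p v.1))
  have ha0 : a x₀ = 0 := by
    funext t
    rcases t with t | v
    · exact nilCoord_eq_zero _ _ _ _ _ (ε t.1 t.2).2.2.1 hx₀r
    · refine cycCoord_eq_zero _ _ _ fun i hi => h0 ?_
      rw [← iterate_fixed hx₀ i, hqi] at hi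
      rw [← hg.1.iterate i hi]
      exact v.2
  have haf : ∀ x, d • a x = a (f x) := by
    intro x
    funext t
    rcases t with t | v
    · exact (nilCoord_apply _ _ _ _ _ (ε t.1 t.2).2.2.1).symm
    · change d • cycCoord g d v.1 (q x) = cycCoord g d v.1 (q (f x))
      rw [hqf, cycCoord_apply hg.1 _ _ _ (hper _)]
  obtain ⟨φ, hφ⟩ := hlift _ a ha0 haf
  have hfiter : ∀ (i : ℕ) u, u ∈ Set.range f^[i] →
      f^[i + 1] (s^[i] u) = f u ∧ f^[i + 1] (s^[i + 1] (f u)) = f u := by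
    intro i u hu
    have hfu : f u ∈ Set.range f^[i + 1] := by
      obtain ⟨y, rfl⟩ := hu
      exact ⟨y, iterate_succ_apply' f i y⟩
    have h1 := hs.iterate_iterate (i := 0) (j := i) (x := u) (by simpa using hu)
    have h2 := hs.iterate_iterate (i := 0) (j := i + 1) (x := f u) (by simpa using hfu)
    simp only [Nat.zero_add, iterate_zero, id] at h1 h2
    exact ⟨by rw [iterate_succ_apply', h1], h2⟩
  have hN : ∀ t, N t • b t = 0 := by
    rintro (t | v)
    · change (d.natAbs ^ ((t.1 : ℕ) + 1)) • (_ - _) = (0 : G)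
      obtain ⟨h1, h2⟩ := hfiter t.1 _ (ε t.1 t.2).2.1
      have : d ^ ((t.1 : ℕ) + 1) • (e (s^[(t.1 : ℕ)] (ε t.1 t.2).1) -
          e (s^[(t.1 : ℕ) + 1] (f (ε t.1 t.2).1))) = 0 := by
        rw [smul_sub, hiter, hiter, h1, h2, sub_self]
      rw [← Int.natAbs_pow]
      rw [← addOrderOf_dvd_iff_nsmul_eq_zero]
      rw [← addOrderOf_dvd_iff_zsmul_eq_zero] at this
      exact Int.natCast_dvd.1 this
    · change (d ^ minimalPeriod g v.1 - 1).natAbs • e (p v.1) = 0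
      have : (d ^ minimalPeriod g v.1 - 1) • e (p v.1) = 0 := by
        rw [sub_smul, hiter, one_smul, sub_eq_zero]
        congr 1
        refine hqinj _ ?_ _ (hpr _) ?_
        · obtain ⟨y, hy⟩ := hpr v.1
          rw [← hy, ← iterate_add_apply]
          exact range_iterate_anti f (Nat.le_add_left _ _) ⟨y, rfl⟩
        · rw [hqi, hpq, iterate_minimalPeriod]
      rw [← addOrderOf_dvd_iff_nsmul_eq_zero]
      rw [← addOrderOf_dvd_iff_zsmul_eq_zero] at this
      exact Int.natCast_dvd.1 this
  have hsingle : ∀ t, φ (b t) = Pi.single t 1 := by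
    rintro (t | v)
    · change φ (e _ - e _) = _
      rw [map_sub, hφ, hφ]
      obtain ⟨h1, h2⟩ := hfiter t.1 _ (ε t.1 t.2).2.1
      funext t'
      rcases t' with t' | v'
      · have hinj : (ε t.1 t.2).1 = (ε t'.1 t'.2).1 → t = t' := by
          intro h
          obtain ⟨i, j⟩ := t
          obtain ⟨i', j'⟩ := t'
          have hii : i = i' := by
            have u1 := (ε i j).2
            have u2 := (ε i' j').2
            simp only at h
            rw [h] at u1
            by_contra hne
            rcases lt_or_gt_of_ne hne with hlt | hlt
            · exact u1.2.1 (range_iterate_anti f hlt u2.1)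
            · exact u2.2.1 (range_iterate_anti f hlt u1.1)
          subst hii
          obtain rfl : j = j' := (ε i).injective (Subtype.ext h)
          rfl
        have := hs.nilCoord_sub d (i' := t'.1) (ε t.1 t.2).2.1
          (ε t'.1 t'.2).2.2.2 (fun h => by rw [hinj h])
        refine this.trans ?_
        by_cases h : t = t'
        · subst h
          rw [if_pos rfl, Pi.single_eq_same]
          rfl
        · rw [if_neg (fun h' => h (hinj h'))]
          exact (Pi.single_eq_of_ne (M := fun t => ZMod (N t)) (i := (Sum.inl t : ι))
            (fun h' => h (Sum.inl_injective h').symm) _).symm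
      · rw [Pi.single_eq_of_ne (by simp)]
        change cycCoord g d v'.1 (q _) - cycCoord g d v'.1 (q _) = 0
        rw [sub_eq_zero]
        congr 1
        refine hg.1.iterate ((t.1 : ℕ) + 1) ?_
        rw [← hqi, ← hqi, h1, h2]
    · change φ (e _) = _
      rw [hφ]
      funext t'
      rcases t' with t' | v'
      · rw [Pi.single_eq_of_ne (by simp)]
        exact nilCoord_eq_zero _ _ _ _ _ (ε t'.1 t'.2).2.2.1 (hper_range _ (hpr _))
      · change cycCoord g d v'.1 (q (p v.1)) = _
        rw [hpq]
        by_cases h : v = v'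
        · subst h
          rw [Pi.single_eq_same]
          exact (cycCoord_iterate hg.1 d v.1 0).trans (pow_zero _)
        · rw [Pi.single_eq_of_ne (fun h' => h (Sum.inr_injective h').symm)]
          refine cycCoord_eq_zero _ _ _ fun i hi => h ?_
          exact Subtype.ext (hsep _ v'.2 _ v.2 ⟨i, hi⟩).symm
  have hb : AddSubgroup.closure (Set.range b) = ⊤ := by
    set H := AddSubgroup.closure (Set.range b) with hH
    have hbH : ∀ t, b t ∈ H := fun t => AddSubgroup.subset_closure ⟨t, rfl⟩
    rw [eq_top_iff, ← hgen, AddSubgroup.closure_le]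
    have hP : ∀ x ∈ Set.range f^[k], e x ∈ H := by
      intro x hx
      by_cases h : q x = q x₀
      · rw [hqinj x hx x₀ (hx₀r k) h, he₀]
        exact H.zero_mem
      · obtain ⟨v, hv, i, hi⟩ := hcover _ h
        have : x = f^[i] (p v) := by
          refine hqinj _ hx _ ?_ ?_
          · obtain ⟨y, hy⟩ := hpr v
            rw [← hy, ← iterate_add_apply]
            exact range_iterate_anti f (Nat.le_add_left _ _) ⟨y, rfl⟩
          · rw [hqi, hpq, hi]
        rw [this, ← hiter]
        exact H.zsmul_mem (hbH (Sum.inr ⟨v, hv⟩)) _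
    have hstep : ∀ u j, u ∈ Set.range f^[j] → e (s^[j] u) - e (s^[j + 1] (f u)) ∈ H := by
      intro u j hu
      by_cases hsu : s (f u) = u
      · rw [iterate_succ_apply, hsu, sub_self]
        exact H.zero_mem
      by_cases huk : u ∈ Set.range f^[k]
      · exfalso
        apply hsu
        have hfu : f u ∈ Set.range f^[k + 1] := by
          obtain ⟨y, rfl⟩ := huk
          exact ⟨y, iterate_succ_apply' f k y⟩
        refine hqinj _ (hs.mem_range _ _ hfu) _ huk (hg.1 ?_)
        rw [← hqf, ← hqf, hs.apply_iterate hfu]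
      · obtain ⟨i, hui, hik, hui'⟩ :
            ∃ i, u ∈ Set.range f^[i] ∧ i < k ∧ u ∉ Set.range f^[i + 1] := by
          by_contra! hcon
          have hall : ∀ i ≤ k, u ∈ Set.range f^[i] := by
            intro i
            induction i with
            | zero => simp
            | succ i ih => exact fun hi => hcon i (ih (by omega)) hi
          exact huk (hall k le_rfl)
        have hji : j ≤ i := by
          by_contra h
          exact hui' (range_iterate_anti f (by omega) hu)
        have hfui : f u ∈ Set.range f^[i + 1] := by
          obtain ⟨y, rfl⟩ := hui
          exact ⟨y, iterate_succ_apply' f i y⟩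
        obtain ⟨r, hr⟩ := (ε ⟨i, hik⟩).surjective ⟨u, hui, hui', hsu⟩
        have hmem := H.zsmul_mem (hbH (Sum.inl ⟨⟨i, hik⟩, r⟩)) (d ^ (i - j))
        change d ^ (i - j) • (e (s^[i] (ε ⟨i, hik⟩ r).1) - e (s^[i + 1] (f (ε ⟨i, hik⟩ r).1))) ∈ H
          at hmem
        rw [hr, smul_sub, hiter, hiter] at hmem
        have e1 := hs.iterate_iterate (i := j) (j := i - j) (x := u)
          (by rwa [Nat.add_sub_cancel' hji])
        have e2 := hs.iterate_iterate (i := j + 1) (j := i - j) (x := f u)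
          (by rwa [show j + 1 + (i - j) = i + 1 by omega])
        rw [Nat.add_sub_cancel' hji] at e1
        rw [show j + 1 + (i - j) = i + 1 by omega] at e2
        rwa [e1, e2] at hmem
    rintro _ ⟨x, rfl⟩
    have hall : ∀ j, e x - e (s^[j] (f^[j] x)) ∈ H := by
      intro j
      induction j with
      | zero => simp
      | succ j ih =>
        have := H.add_mem ih (hstep (f^[j] x) j ⟨x, rfl⟩)
        rwa [sub_add_sub_cancel, ← iterate_succ_apply' f] at this
    have h1 := hall k
    have h2 : e (s^[k] (f^[k] x)) ∈ H :=
      hP _ (hs.iterate_mem (hper_range _ ⟨x, rfl⟩ _))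
    simpa using H.add_mem h1 h2
  let E := AddEquiv.ofBijective φ (bijective_of_map_eq_single N φ b hN hsingle hb)
  exact ⟨E.trans
    { toFun := fun t => (fun i j => t (Sum.inl ⟨i, j⟩), fun v => t (Sum.inr v))
      invFun := fun t r => match r with
        | Sum.inl r => t.1 r.1 r.2
        | Sum.inr v => t.2 v
      left_inv := fun t => by funext r; rcases r with r | r <;> rfl
      right_inv := fun t => rfl
      map_add' := fun _ _ => rfl }⟩

end FunctionalGraph

theorem isUnit_intCast_of_gcd_natAbs_eq_one {m : ℕ} {d : ℤ} (h : m.gcd d.natAbs = 1) :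
    IsUnit (d : ZMod m) := by
  have h : IsUnit (d.natAbs : ZMod m) := (ZMod.isUnit_iff_coprime _ _).2 (Nat.Coprime.symm h)
  rcases Int.natAbs_eq d with hd | hd
  · rw [hd, Int.cast_natCast]
    exact h
  · rw [hd, Int.cast_neg, Int.cast_natCast]
    exact h.neg

theorem dSeq_eq_div_gcd (n : ℕ) (d : ℤ) (i : ℕ) :
    dSeq n d i = n / n.gcd (d.natAbs ^ i) := by
  induction i with
  | zero => simp [dSeq]
  | succ i ih =>
    rw [dSeq, ih, Nat.div_div_eq_div_mul, ← Nat.gcd_mul_left,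
      Nat.mul_div_cancel' (Nat.gcd_dvd_left _ _)]
    congr 1
    rw [← Nat.gcd_mul_right, ← Nat.gcd_assoc, pow_succ]
    congr 1
    exact Nat.gcd_eq_left (Dvd.intro _ rfl)

theorem intCast_pow_mul_eq_zero_iff {n : ℕ} (hn : 1 ≤ n) (d a : ℤ) (i : ℕ) :
    (d : ZMod n) ^ i * (a : ZMod n) = 0 ↔ ((dSeq n d i : ℕ) : ℤ) ∣ a := by
  rw [dSeq_eq_div_gcd, ← Int.cast_pow, ← Int.cast_mul, ZMod.intCast_zmod_eq_zero_iff_dvd,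
    Int.natCast_dvd, Int.natCast_dvd, Int.natAbs_mul, Int.natAbs_pow]
  have hg : 0 < n.gcd (d.natAbs ^ i) := Nat.gcd_pos_of_pos_left _ hn
  obtain ⟨n', hn'⟩ := Nat.gcd_dvd_left n (d.natAbs ^ i)
  obtain ⟨b, hb⟩ := Nat.gcd_dvd_right n (d.natAbs ^ i)
  have hcop := Nat.coprime_div_gcd_div_gcd hg
  rw [Nat.div_eq_of_eq_mul_right hg hn', Nat.div_eq_of_eq_mul_right hg hb] at hcop
  rw [Nat.div_eq_of_eq_mul_right hg hn']
  generalize n.gcd (d.natAbs ^ i) = g at *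
  rw [hn', hb, Nat.mul_assoc, Nat.mul_dvd_mul_iff_left hg]
  exact hcop.dvd_mul_left

theorem ncard_range_mul (n : ℕ) (hn : 1 ≤ n) (d : ℤ) (i : ℕ) :
    (Set.range fun x : ZMod n => (d : ZMod n) ^ i * x).ncard = dSeq n d i := by
  have : NeZero n := ⟨by omega⟩
  have hset : (Set.range fun x : ZMod n => (d : ZMod n) ^ i * x) =
      (AddSubgroup.zmultiples ((d : ZMod n) ^ i) : Set (ZMod n)) := by
    ext y
    simp only [Set.mem_range, SetLike.mem_coe, AddSubgroup.mem_zmultiples_iff]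
    constructor
    · rintro ⟨x, rfl⟩
      obtain ⟨z, rfl⟩ := ZMod.intCast_surjective x
      exact ⟨z, by rw [zsmul_eq_mul, mul_comm]⟩
    · rintro ⟨z, rfl⟩
      exact ⟨z, by rw [zsmul_eq_mul, mul_comm]⟩
  rw [hset, ← Nat.card_coe_set_eq]
  refine (Nat.card_zmultiples _).trans ?_
  refine Nat.dvd_antisymm ?_ ?_
  · rw [addOrderOf_dvd_iff_nsmul_eq_zero, nsmul_eq_mul, mul_comm]
    have := (intCast_pow_mul_eq_zero_iff hn d (dSeq n d i) i).2 dvd_rfl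
    simpa using this
  · have h := addOrderOf_nsmul_eq_zero ((d : ZMod n) ^ i)
    rw [nsmul_eq_mul, mul_comm] at h
    have := (intCast_pow_mul_eq_zero_iff hn d (addOrderOf ((d : ZMod n) ^ i)) i).1
      (by simpa using h)
    exact_mod_cast this

theorem eV_zero (n : ℕ) : eV n 0 = 0 := by
  simp [eV, xp, AddMonoidAlgebra.one_def]

theorem exists_int_rep {n : ℕ} (hn : 1 ≤ n) (x : ZMod n) (hx : x ≠ 0) :
    ∃ v : ℤ, 1 ≤ v ∧ v ≤ (n : ℤ) - 1 ∧ (v : ZMod n) = x := by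
  have : NeZero n := ⟨by omega⟩
  have h1 := x.val_lt
  have h2 : x.val ≠ 0 := by simpa using hx
  exact ⟨x.val, by omega, by omega, by simp⟩

theorem eV_mem_ZSpan {n : ℕ} (hn : 1 ≤ n) (x : ZMod n) : eV n x ∈ ZSpan n := by
  by_cases hx : x = 0
  · rw [hx, eV_zero]
    exact zero_mem _
  · obtain ⟨v, h1, h2, rfl⟩ := exists_int_rep hn x hx
    exact Submodule.subset_span ⟨v, h1, h2, rfl⟩

theorem epsV_mem_ESpan {n : ℕ} (hn : 1 ≤ n) (d : ℤ) (x : ZMod n) : epsV n d x ∈ ESpan n d := by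
  by_cases hx : x = 0
  · rw [hx, epsV, mul_zero, eV_zero, smul_zero, sub_zero]
    exact zero_mem _
  · obtain ⟨v, h1, h2, rfl⟩ := exists_int_rep hn x hx
    exact Submodule.subset_span ⟨v, h1, h2, rfl⟩

/-- The class of `e_x` in the sand dune group. -/
def duneClass {n : ℕ} (hn : 1 ≤ n) (d : ℤ) (x : ZMod n) : SandDune n d :=
  Submodule.Quotient.mk ⟨eV n x, eV_mem_ZSpan hn x⟩

theorem duneClass_zero {n : ℕ} (hn : 1 ≤ n) (d : ℤ) : duneClass hn d 0 = 0 := by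
  rw [duneClass, Submodule.Quotient.mk_eq_zero, Submodule.mem_comap]
  simp [eV_zero]

theorem smul_duneClass {n : ℕ} (hn : 1 ≤ n) (d : ℤ) (x : ZMod n) :
    d • duneClass hn d x = duneClass hn d ((d : ZMod n) * x) := by
  rw [duneClass, duneClass, ← Submodule.Quotient.mk_smul, Submodule.Quotient.eq,
    Submodule.mem_comap]
  exact epsV_mem_ESpan hn d x

theorem closure_range_duneClass {n : ℕ} (hn : 1 ≤ n) (d : ℤ) :
    AddSubgroup.closure (Set.range (duneClass hn d)) = ⊤ := by
  rw [eq_top_iff]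
  rintro y -
  obtain ⟨⟨z, hz⟩, rfl⟩ := Submodule.Quotient.mk_surjective _ y
  induction hz using Submodule.span_induction with
  | mem z h =>
    obtain ⟨v, -, -, rfl⟩ := h
    exact AddSubgroup.subset_closure ⟨v, rfl⟩
  | zero => exact zero_mem _
  | add a b ha hb iha ihb => exact add_mem iha ihb
  | smul r a ha ih => exact AddSubgroup.zsmul_mem _ ih r

theorem exists_lift_duneClass {n : ℕ} (hn : 1 ≤ n) (d : ℤ) (A : Type) [AddCommGroup A]
    (a : ZMod n → A) (h0 : a 0 = 0) (h : ∀ x, d • a x = a ((d : ZMod n) * x)) :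
    ∃ φ : SandDune n d →+ A, ∀ x, φ (duneClass hn d x) = a x := by
  let L : Rn n →ₗ[ℤ] A :=
    (Finsupp.linearCombination ℤ a).comp (AddMonoidAlgebra.coeffLinearEquiv ℤ).toLinearMap
  have hL : ∀ x, L (eV n x) = a x := by
    intro x
    have h1 : ∀ y, L (xp n y) = a y := by
      intro y
      simp [L, xp]
    rw [eV, map_sub, h1, AddMonoidAlgebra.one_def]
    have := h1 0
    rw [xp] at this
    rw [this, h0, sub_zero]
  have hker : Submodule.comap (ZSpan n).subtype (ESpan n d) ≤
      LinearMap.ker (L.comp (ZSpan n).subtype) := by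
    rw [LinearMap.ker_comp]
    refine Submodule.comap_mono ?_
    rw [ESpan, Submodule.span_le]
    rintro _ ⟨v, -, -, rfl⟩
    rw [SetLike.mem_coe, LinearMap.mem_ker, epsV, map_sub, map_smul, hL, hL, h, sub_self]
  exact ⟨(Submodule.liftQ _ (L.comp (ZSpan n).subtype) hker).toAddMonoidHom, hL⟩

/-- with `d`-sequence `n = n_0 > ⋯ > n_k = n_{k+1}`, `m = n_k`, and a
set `𝒱` of representatives of the nonzero orbits of `v ↦ d·v` on `ℤ/m` with orbit
sizes `o(v)` (least `e ≥ 1` with `d^e·v = v`), one has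
`Σ(n,d) ≅ [⊕_{i<k} (ℤ/|d|^{i+1})^{n_i − 2n_{i+1} + n_{i+2}}] ⊕ [⊕_{v∈𝒱} ℤ/|d^{o(v)} − 1|]`. -/
theorem stmt15 (n : ℕ) (d : ℤ) (hn : 1 ≤ n) (hd : 2 ≤ |d|) (k : ℕ)
    (hk1 : Nat.gcd (dSeq n d k) d.natAbs = 1)
    (hk2 : ∀ i < k, Nat.gcd (dSeq n d i) d.natAbs ≠ 1)
    (V : Finset (ZMod (dSeq n d k))) (h0 : (0 : ZMod (dSeq n d k)) ∉ V)
    (hcover : ∀ w : ZMod (dSeq n d k), w ≠ 0 →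
      ∃ v ∈ V, ∃ i : ℕ, (d : ZMod (dSeq n d k)) ^ i * v = w)
    (hsep : ∀ v ∈ V, ∀ v' ∈ V,
      (∃ i : ℕ, (d : ZMod (dSeq n d k)) ^ i * v = v') → v = v')
    (o : ZMod (dSeq n d k) → ℕ)
    (ho : ∀ w : ZMod (dSeq n d k), 0 < o w ∧ (d : ZMod (dSeq n d k)) ^ (o w) * w = w ∧
      ∀ e : ℕ, 0 < e → (d : ZMod (dSeq n d k)) ^ e * w = w → o w ≤ e) :
    Nonempty (SandDune n d ≃+
      (((i : Fin k) →
        (Fin (((dSeq n d i.1 : ℤ) - 2 * (dSeq n d (i.1 + 1) : ℤ) +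
            (dSeq n d (i.1 + 2) : ℤ)).toNat) →
          ZMod (d.natAbs ^ (i.1 + 1)))) ×
        ((v : V) → ZMod ((d ^ o v.1 - 1).natAbs)))) := by
  have hn0 : NeZero n := ⟨by omega⟩
  have hdvd : dSeq n d k ∣ n := by
    rw [dSeq_eq_div_gcd]
    exact Nat.div_dvd_of_dvd (Nat.gcd_dvd_left _ _)
  have hiterate : ∀ {m : ℕ} (i : ℕ), (fun x : ZMod m => (d : ZMod m) * x)^[i] =
      fun x => (d : ZMod m) ^ i * x := fun i => mul_left_iterate _ i
  have hminper : ∀ w, Function.minimalPeriod (fun x : ZMod (dSeq n d k) => (d : ZMod _) * x) w = o w := by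
    intro w
    obtain ⟨h1, h2, h3⟩ := ho w
    have hp : Function.IsPeriodicPt (fun x : ZMod (dSeq n d k) => (d : ZMod _) * x) (o w) w := by
      rw [Function.IsPeriodicPt, Function.IsFixedPt, hiterate]
      exact h2
    refine le_antisymm (hp.minimalPeriod_le h1) (h3 _ (hp.minimalPeriod_pos h1) ?_)
    have := Function.iterate_minimalPeriod (f := fun x : ZMod (dSeq n d k) => (d : ZMod _) * x) (x := w)
    rwa [hiterate] at this
  obtain rfl := funext hminper
  have hunit : IsUnit (d : ZMod (dSeq n d k)) :=
    isUnit_intCast_of_gcd_natAbs_eq_one hk1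
  have key := addEquiv_of_functional_graph (fun x : ZMod n => (d : ZMod n) * x)
    (fun x : ZMod (dSeq n d k) => (d : ZMod _) * x) (ZMod.castHom hdvd (ZMod (dSeq n d k))) 0 d k
    (duneClass hn d) (mul_zero _) (ZMod.castHom_surjective hdvd) (fun x => by rw [map_mul, map_intCast]) ?_
    (IsUnit.isUnit_iff_mulLeft_bijective.1 hunit) (duneClass_zero hn d) (smul_duneClass hn d)
    (closure_range_duneClass hn d) (fun A _ => exists_lift_duneClass hn d A) V
    (by rwa [map_zero]) ?_ ?_ (fun v => (ho v).1)
    (fun i => ((dSeq n d i.1 : ℤ) - 2 * (dSeq n d (i.1 + 1) : ℤ) +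
            (dSeq n d (i.1 + 2) : ℤ)).toNat) ?_
  · exact key
  · intro x y
    obtain ⟨a, rfl⟩ := ZMod.intCast_surjective x
    obtain ⟨b, rfl⟩ := ZMod.intCast_surjective y
    rw [hiterate, ← sub_eq_zero, ← map_sub, ← sub_eq_zero (b := _ * _), ← mul_sub,
      ← Int.cast_sub, intCast_pow_mul_eq_zero_iff hn, map_intCast,
      ZMod.intCast_zmod_eq_zero_iff_dvd]
  · simpa only [hiterate, map_zero] using hcover
  · simpa only [hiterate] using hsep
  · intro i
    simp only [hiterate, ncard_range_mul n hn]
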